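/- Let {ĝ_n}_{n∈ℕ} ⊂ C[−π,π] satisfy: (i) sup_n ‖ĝ_n‖_{L^∞[−π,π]} < ∞ and inf_n ‖ĝ_n‖_{L^∞[−π,π]} > 0; (ii) {ĝ_n} is closed in C[−π,π] (finite linear combinations are uniformly dense) and minimal (no ĝ_m lies in the closed linear span of {ĝ_n}_{n≠m}); (iii) there is C₁₃ > 0 with ‖Σ_n a_n ĝ_n‖_{L^∞[−π,π]} ≥ C₁₃^{−1} (Σ_n |a_n|²)^{1/2} for all finite scalar sequences {a_n}. Let {u_n}_{n∈ℕ} be the unique sequence of continuous linear functionals on C[−π,π] biorthogonal to {ĝ_n} (u_n(ĝ_m) = δ_{nm}), and for ĥ ∈ C[−π,π] and t ∈ ℝ set w_n(ĥ, t) = u_n(ω ↦ ĥ(ω) e^{iωt}) and, for f ∈ PW¹_π, c_n(f, t) = (1/(2π)) ∫_{−π}^{π} f̂(ω) ĝ_n(ω) e^{iωt} dω. Then for every t ∈ ℝ there exist ĥ_{*2} ∈ C[−π,π] and f_{*2} ∈ PW¹_π such that limsup_{N→∞} | Σ_{n=1}^{N} c_n(f_{*2}, 0) w_n(ĥ_{*2},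 t) | = ∞. -/

import Mathlib

open MeasureTheory Filter Finset

/-- Evaluation of a continuous function on `[-π,π]` at a real point (via the projection
onto `[-π,π]`; for `ω ∈ [-π,π]` this is just evaluation at `ω`). -/
noncomputable def evalR (g : C(↥(Set.Icc (-Real.pi) Real.pi), ℂ)) (ω : ℝ) : ℂ :=
  g (Set.projIcc (-Real.pi) Real.pi (by linarith [Real.pi_pos]) ω)

/-- The continuous function `ω ↦ e^{iωt}` on `[-π,π]`. -/
noncomputable def expCM (t : ℝ) : C(↥(Set.Icc (-Real.pi) Real.pi), ℂ) :=
  ⟨fun ω => Complex.exp (Complex.I * ((ω : ℝ) : ℂ) * (t : ℂ)), by fun_prop⟩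


noncomputable def sgB (b : Bool) : ℂ := if b then 1 else -1

lemma sum_fun_succ (n : ℕ) (f : (Fin (n+1) → Bool) → ℝ) :
    ∑ σ : Fin (n+1) → Bool, f σ
      = ∑ σ : Fin n → Bool, (f (Fin.cons true σ) + f (Fin.cons false σ)) := by
  rw [← (Fin.consEquiv (fun _ : Fin (n+1) => Bool)).sum_comp, Fintype.sum_prod_type]
  simp [Fin.consEquiv, Finset.sum_add_distrib]

lemma par2 (x h : ℂ) : ‖x + h‖^2 + ‖x - h‖^2 = 2 * (‖x‖^2 + ‖h‖^2) := by
  have := parallelogram_law_with_norm ℝ x h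
  nlinarith

lemma par4 (x h : ℂ) : ‖x + h‖^4 + ‖x - h‖^4 ≤ 2 * (‖x‖^4 + 6 * ‖x‖^2 * ‖h‖^2 + ‖h‖^4) := by
  have e : ∀ z : ℂ, ‖z‖^4 = (‖z‖^2)^2 := fun z => by ring
  simp only [e, Complex.sq_norm, Complex.normSq_apply, Complex.add_re, Complex.add_im,
    Complex.sub_re, Complex.sub_im]
  nlinarith [sq_nonneg (x.re * h.im - x.im * h.re)]

lemma sign2 (n : ℕ) (z : Fin n → ℂ) :
    ∑ σ : Fin n → Bool, ‖∑ s, sgB (σ s) * z s‖^2 = 2^n * ∑ s, ‖z s‖^2 := by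
  induction n with
  | zero => simp
  | succ n ih =>
    rw [sum_fun_succ]
    have : ∀ σ : Fin n → Bool,
        ‖∑ s, sgB ((Fin.cons true σ : Fin (n+1) → Bool) s) * z s‖^2
        + ‖∑ s, sgB ((Fin.cons false σ : Fin (n+1) → Bool) s) * z s‖^2
        = 2 * ‖∑ s : Fin n, sgB (σ s) * z s.succ‖^2 + 2 * ‖z 0‖^2 := by
      intro σ
      simp only [Fin.sum_univ_succ, Fin.cons_zero, Fin.cons_succ]
      have := par2 (∑ s : Fin n, sgB (σ s) * z s.succ) (z 0)
      simp only [sgB, if_true, one_mul, Bool.false_eq_true, if_false, neg_mul] at this ⊢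
      rw [add_comm (z 0), add_comm (-z 0), ← sub_eq_add_neg]
      linarith
    rw [Finset.sum_congr rfl (fun σ _ => this σ), Finset.sum_add_distrib, ← Finset.mul_sum,
      ih (fun s => z s.succ), Fin.sum_univ_succ]
    simp
    ring

lemma sign4 (n : ℕ) (z : Fin n → ℂ) :
    ∑ σ : Fin n → Bool, ‖∑ s, sgB (σ s) * z s‖^4 ≤ 3 * 2^n * (∑ s, ‖z s‖^2)^2 := by
  induction n with
  | zero => simp
  | succ n ih =>
    rw [sum_fun_succ]
    have : ∀ σ : Fin n → Bool,
        ‖∑ s, sgB ((Fin.cons true σ : Fin (n+1) → Bool) s) * z s‖^4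
        + ‖∑ s, sgB ((Fin.cons false σ : Fin (n+1) → Bool) s) * z s‖^4
        ≤ 2 * ‖∑ s : Fin n, sgB (σ s) * z s.succ‖^4 
          + 12 * ‖z 0‖^2 * ‖∑ s : Fin n, sgB (σ s) * z s.succ‖^2 + 2 * ‖z 0‖^4 := by
      intro σ
      simp only [Fin.sum_univ_succ, Fin.cons_zero, Fin.cons_succ]
      have := par4 (∑ s : Fin n, sgB (σ s) * z s.succ) (z 0)
      simp only [sgB, if_true, one_mul, Bool.false_eq_true, if_false, neg_mul] at this ⊢
      rw [add_comm (z 0), add_comm (-z 0), ← sub_eq_add_neg]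
      linarith
    refine (Finset.sum_le_sum (fun σ _ => this σ)).trans ?_
    rw [Finset.sum_add_distrib, Finset.sum_add_distrib, ← Finset.mul_sum, ← Finset.mul_sum,
      sign2 n (fun s => z s.succ), Fin.sum_univ_succ]
    have h1 := ih (fun s => z s.succ)
    simp only [Finset.sum_const, Finset.card_univ, Fintype.card_fun, Fintype.card_bool,
      Fintype.card_fin, nsmul_eq_mul, Nat.cast_pow, Nat.cast_ofNat] at h1 ⊢
    set s := ∑ i : Fin n, ‖z i.succ‖^2
    have h2 : (0:ℝ) < 2^n := by positivity
    rw [pow_succ (2:ℝ) n]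
    nlinarith [mul_nonneg h2.le (sq_nonneg (‖z 0‖^2))]

/-- squared `ℓ²` norm of the image -/
noncomputable def qf {ι : Type} [Fintype ι] (n : ℕ) (v : ℕ → ι → ℂ) (h : ι → ℂ) : ℝ :=
  ∑ k ∈ range n, ‖∑ i, v k i * h i‖^2

def Summing {ι : Type} [Fintype ι] (n : ℕ) (v : ℕ → ι → ℂ) (A : ℝ) : Prop :=
  ∀ (S : Type) [Fintype S] (h : S → ι → ℂ) (R : ℝ), 0 ≤ R → (∀ i, ∑ s, ‖h s i‖^2 ≤ R) →
    ∑ s, qf n v (h s) ≤ A * R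

lemma qf_add {ι : Type} [Fintype ι] (n : ℕ) (v : ℕ → ι → ℂ) (a b : ι → ℂ) :
    qf n v (a + b) ≤ 2 * qf n v a + 2 * qf n v b := by
  unfold qf
  rw [Finset.mul_sum, Finset.mul_sum, ← Finset.sum_add_distrib]
  refine Finset.sum_le_sum fun k _ => ?_
  have : ∑ i, v k i * (a + b) i = ∑ i, v k i * a i + ∑ i, v k i * b i := by
    simp [mul_add, Finset.sum_add_distrib]
  rw [this]
  have := par2 (∑ i, v k i * a i) (∑ i, v k i * b i)
  nlinarith [sq_nonneg ‖∑ i, v k i * a i - ∑ i, v k i * b i‖]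

lemma qf_sign {ι : Type} [Fintype ι] (n : ℕ) (v : ℕ → ι → ℂ) (N : ℕ) (h : Fin N → ι → ℂ) :
    ∑ σ : Fin N → Bool, qf n v (fun i => ∑ s, sgB (σ s) * h s i) = 2^N * ∑ s, qf n v (h s) := by
  unfold qf
  rw [Finset.sum_comm]
  conv_rhs => rw [Finset.sum_comm, Finset.mul_sum]
  refine Finset.sum_congr rfl fun k _ => ?_
  rw [← sign2]
  refine Finset.sum_congr rfl fun σ _ => ?_
  congr 2
  simp_rw [Finset.mul_sum]
  rw [Finset.sum_comm]
  refine Finset.sum_congr rfl fun s _ => Finset.sum_congr rfl fun i _ => by ring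

lemma summing_start {ι : Type} [Fintype ι] (n : ℕ) (v : ℕ → ι → ℂ) : ∃ A, 0 ≤ A ∧ Summing n v A := by
  refine ⟨∑ k ∈ range n, (∑ i, ‖v k i‖^2) * Fintype.card ι, by positivity, ?_⟩
  intro S _ h R hR hh
  unfold qf
  rw [Finset.sum_comm, Finset.sum_mul]
  refine Finset.sum_le_sum fun k _ => ?_
  have : ∀ s, ‖∑ i, v k i * h s i‖^2 ≤ (∑ i, ‖v k i‖^2) * ∑ i, ‖h s i‖^2 := by
    intro s
    refine le_trans ?_ (Finset.sum_mul_sq_le_sq_mul_sq _ _ _)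
    gcongr
    refine (norm_sum_le _ _).trans (le_of_eq ?_)
    simp
  refine (Finset.sum_le_sum fun s _ => this s).trans ?_
  rw [← Finset.mul_sum, Finset.sum_comm, mul_assoc]
  gcongr
  refine (Finset.sum_le_sum fun i _ => hh i).trans ?_
  simp

lemma trunc_ex (M : ℝ) (hM : 0 < M) (z : ℂ) :
    ∃ a b : ℂ, z = a + b ∧ ‖a‖ ≤ M ∧ ‖b‖^2 ≤ ‖z‖^4 / M^2 := by
  by_cases h : ‖z‖ ≤ M
  · exact ⟨z, 0, by simp, h, by simp; positivity⟩
  · refine ⟨0, z, by simp, by simpa using hM.le, ?_⟩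
    push Not at h
    rw [le_div_iff₀ (by positivity)]
    have : M^2 ≤ ‖z‖^2 := by gcongr
    nlinarith [sq_nonneg ‖z‖]

lemma summing_step {ι : Type} [Fintype ι] (n : ℕ) (v : ℕ → ι → ℂ) (C0 A : ℝ) (_hA : 0 ≤ A)
    (hC : ∀ (h : ι → ℂ) (r : ℝ), 0 ≤ r → (∀ i, ‖h i‖ ≤ r) → qf n v h ≤ C0 * r^2)
    (hS : Summing n v A) : Summing n v (24 * C0 + A / 2) := by
  intro S _ h0 R hR hh0
  let e := Fintype.equivFin S
  set N := Fintype.card S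
  let h : Fin N → ι → ℂ := fun s => h0 (e.symm s)
  have hh : ∀ i, ∑ s, ‖h s i‖^2 ≤ R := by
    intro i
    refine le_trans (le_of_eq ?_) (hh0 i)
    exact e.symm.sum_comp (fun s => ‖h0 s i‖^2)
  have hq : ∑ s, qf n v (h0 s) = ∑ s, qf n v (h s) :=
    (e.symm.sum_comp (fun s => qf n v (h0 s))).symm
  rw [hq]
  rcases hR.eq_or_lt with hR0 | hRpos
  · have : ∀ s, qf n v (h s) = 0 := by
      intro s
      have : ∀ i, h s i = 0 := by
        intro i
        have h1 := hh i
        have h2 := Finset.single_le_sum (f := fun s => ‖h s i‖^2) (fun s _ => by positivity) (Finset.mem_univ s)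
        have : ‖h s i‖^2 ≤ 0 := by linarith
        have := pow_eq_zero_iff (two_ne_zero) |>.1 (le_antisymm this (by positivity))
        simpa using this
      simp [qf, this]
    simp [this, ← hR0]
  have hMpos : 0 < Real.sqrt (12 * R) := by positivity
  have hM2 : Real.sqrt (12 * R)^2 = 12 * R := Real.sq_sqrt (by positivity)
  choose a b hab ha hb using trunc_ex (Real.sqrt (12 * R)) hMpos
  let H : (Fin N → Bool) → ι → ℂ := fun σ i => ∑ s, sgB (σ s) * h s i
  have h1 : ∑ σ, qf n v (H σ) = 2^N * ∑ s, qf n v (h s) := qf_sign n v N h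
  have h2 : ∀ σ, qf n v (H σ) ≤ 2 * qf n v (fun i => a (H σ i)) + 2 * qf n v (fun i => b (H σ i)) := by
    intro σ
    refine le_trans (le_of_eq ?_) (qf_add n v _ _)
    congr 1
    ext i
    exact hab _
  have h3 : ∀ σ, qf n v (fun i => a (H σ i)) ≤ C0 * (12 * R) := by
    intro σ
    rw [← hM2]
    exact hC _ _ hMpos.le (fun i => ha _)
  have h4 : ∑ σ, qf n v (fun i => b (H σ i)) ≤ A * (2^N * R / 4) := by
    refine hS (Fin N → Bool) (fun σ i => b (H σ i)) _ (by positivity) ?_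
    intro i
    calc ∑ σ, ‖b (H σ i)‖^2 ≤ ∑ σ, ‖H σ i‖^4 / (12 * R) := by
          refine Finset.sum_le_sum fun σ _ => ?_
          rw [← hM2]; exact hb _
      _ = (∑ σ, ‖H σ i‖^4) / (12 * R) := by rw [Finset.sum_div]
      _ ≤ (3 * 2^N * R^2) / (12 * R) := by
          gcongr
          refine (sign4 N (fun s => h s i)).trans ?_
          gcongr
          exact hh i
      _ = _ := by field_simp; norm_num
  have h5 := Finset.sum_le_sum (fun σ (_ : σ ∈ (Finset.univ : Finset (Fin N → Bool))) => h2 σ)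
  rw [h1, Finset.sum_add_distrib, ← Finset.mul_sum, ← Finset.mul_sum] at h5
  have h6 := Finset.sum_le_sum (fun σ (_ : σ ∈ (Finset.univ : Finset (Fin N → Bool))) => h3 σ)
  simp only [Finset.sum_const, Finset.card_univ, Fintype.card_fun, Fintype.card_bool,
      Fintype.card_fin, nsmul_eq_mul, Nat.cast_pow, Nat.cast_ofNat] at h6
  have hp : (0:ℝ) < 2^N := by positivity
  have : (2:ℝ)^N * ∑ s, qf n v (h s) ≤ 2^N * ((24 * C0 + A / 2) * R) := by nlinarith
  exact le_of_mul_le_mul_left this hp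

lemma summing_final {ι : Type} [Fintype ι] (n : ℕ) (v : ℕ → ι → ℂ) (C0 : ℝ) (hC0 : 0 < C0)
    (hC : ∀ (h : ι → ℂ) (r : ℝ), 0 ≤ r → (∀ i, ‖h i‖ ≤ r) → qf n v h ≤ C0 * r^2) :
    Summing n v (49 * C0) := by
  obtain ⟨A, hA, hS⟩ := summing_start n v
  have : ∀ k : ℕ, Summing n v (48 * C0 + A / 2^k) := by
    intro k
    induction k with
    | zero =>
      intro S _ h R hR hh
      refine (hS S h R hR hh).trans ?_
      gcongr
      simp; positivity
    | succ k ih =>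
      have := summing_step n v C0 _ (by positivity) hC ih
      convert this using 1
      rw [pow_succ]; field_simp; ring
  obtain ⟨k, hk⟩ := pow_unbounded_of_one_lt (A / C0) (one_lt_two (α := ℝ))
  intro S _ h R hR hh
  refine (this k S h R hR hh).trans ?_
  gcongr
  have : A / 2^k ≤ C0 := by
    rw [div_le_iff₀ (by positivity)]
    rw [div_lt_iff₀ hC0] at hk
    linarith
  linarith

lemma pietsch {ι : Type} [Fintype ι] [Nonempty ι] (n : ℕ) (v : ℕ → ι → ℂ) (A : ℝ) (_hA : 0 ≤ A)
    (hS : Summing n v A) :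
    ∃ μ : ι → ℝ, (∀ i, 0 ≤ μ i) ∧ ∑ i, μ i = 1 ∧
      ∀ h : ι → ℂ, qf n v h ≤ A * ∑ i, μ i * ‖h i‖^2 := by
  classical
  let O : Set (ι → ℝ) := {a | ∀ i, a i < 0}
  let W : Set (ι → ℝ) := {a | ∃ (S : Type) (_ : Fintype S) (h : S → ι → ℂ),
    ∀ i, a i = A * ∑ s, ‖h s i‖^2 - ∑ s, qf n v (h s)}
  have hqs : ∀ (t : ℝ), 0 ≤ t → ∀ h : ι → ℂ,
      qf n v (fun i => (Real.sqrt t : ℂ) * h i) = t * qf n v h := by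
    intro t ht h
    unfold qf
    rw [Finset.mul_sum]
    refine Finset.sum_congr rfl fun k _ => ?_
    have : ∑ i, v k i * ((Real.sqrt t : ℂ) * h i) = (Real.sqrt t : ℂ) * ∑ i, v k i * h i := by
      rw [Finset.mul_sum]
      exact Finset.sum_congr rfl fun i _ => by ring
    rw [this, norm_mul, mul_pow]
    simp [Real.sq_sqrt ht]
  have hns : ∀ (t : ℝ), 0 ≤ t → ∀ z : ℂ, ‖(Real.sqrt t : ℂ) * z‖^2 = t * ‖z‖^2 := by
    intro t ht z
    rw [norm_mul, mul_pow]
    simp [Real.sq_sqrt ht]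
  have hOc : Convex ℝ O := by
    intro a ha b hb s t hs ht hst i
    have h1 := ha i
    have h2 := hb i
    simp only [Pi.add_apply, Pi.smul_apply, smul_eq_mul]
    rcases hs.eq_or_lt with h | h
    · have : t = 1 := by linarith
      rw [← h, this]; simpa using h2
    · nlinarith [mul_pos h (neg_pos.2 h1), mul_nonneg ht (neg_pos.2 h2).le]
  have hOo : IsOpen O := by
    have : O = ⋂ i, {a : ι → ℝ | a i < 0} := by ext; simp [O]
    rw [this]
    exact isOpen_iInter_of_finite fun i => isOpen_lt (continuous_apply i) continuous_const
  have hWc : Convex ℝ W := by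
    rintro a ⟨S, _, h, ha⟩ b ⟨S', _, h', hb⟩ s t hs ht hst
    refine ⟨S ⊕ S', inferInstance, Sum.elim (fun x i => (Real.sqrt s : ℂ) * h x i)
      (fun x i => (Real.sqrt t : ℂ) * h' x i), fun i => ?_⟩
    simp only [Pi.add_apply, Pi.smul_apply, smul_eq_mul, ha, hb, Fintype.sum_sum_type,
      Sum.elim_inl, Sum.elim_inr, hqs s hs, hqs t ht, hns s hs, hns t ht, ← Finset.mul_sum]
    ring
  have hdis : Disjoint O W := by
    rw [Set.disjoint_left]
    rintro a haO ⟨S, _, h, ha⟩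
    obtain ⟨i0, -, hi0⟩ := Finset.exists_max_image Finset.univ (fun i => ∑ s, ‖h s i‖^2)
      Finset.univ_nonempty
    have h1 := hS S h (∑ s, ‖h s i0‖^2) (by positivity) (fun i => hi0 i (Finset.mem_univ i))
    have h2 := haO i0
    rw [ha] at h2
    linarith
  obtain ⟨f, c, hfO, hfW⟩ := geometric_hahn_banach_open hOc hOo hWc hdis
  have hc0 : c ≤ 0 := by
    have : (0 : ι → ℝ) ∈ W := ⟨Empty, inferInstance, fun x => x.elim, fun i => by simp⟩
    simpa using hfW _ this
  have hfneg : ∀ a ∈ O, f a < 0 := fun a ha => (hfO a ha).trans_le hc0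
  have hone : 0 < f (fun _ => 1) := by
    have := hfneg (-(fun _ => 1)) (fun i => by simp)
    rw [map_neg] at this
    linarith
  have hc0' : 0 ≤ c := by
    by_contra hlt
    push Not at hlt
    have := hfO ((-((-c) / (2 * f (fun _ => 1)))) • (fun _ => (1:ℝ))) (fun i => by
      simp only [Pi.smul_apply, smul_eq_mul, mul_one, neg_lt_zero]
      have : 0 < -c := by linarith
      positivity)
    rw [map_smul, smul_eq_mul] at this
    have h3 : -(-c / (2 * f (fun _ => 1))) * f (fun _ => 1) = c / 2 := by
      field_simp
    rw [h3] at this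
    linarith
  have hfsum : ∀ a : ι → ℝ, f a = ∑ i, a i * f (Pi.single i 1) := by
    intro a
    conv_lhs => rw [← Finset.univ_sum_single a]
    rw [map_sum]
    refine Finset.sum_congr rfl fun i _ => ?_
    have : (Pi.single i (a i) : ι → ℝ) = a i • Pi.single i 1 := by
      rw [← Pi.single_smul]; simp
    rw [this, map_smul, smul_eq_mul]
  have hw : ∀ i, 0 ≤ f (Pi.single i 1) := by
    intro i
    by_contra hlt
    push Not at hlt
    set w := f (Pi.single i 1)
    set F := f (fun _ => 1)
    have := hfneg (-(Pi.single i 1 + ((-w) / (2 * F)) • (fun _ => (1:ℝ)))) (fun j => by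
      have h1 : 0 ≤ (Pi.single i 1 : ι → ℝ) j := by
        by_cases h : j = i
        · subst h; simp
        · simp [h]
      have h2 : 0 < (-w) / (2 * F) := by
        have : 0 < -w := by linarith
        positivity
      simp only [Pi.neg_apply, Pi.add_apply, Pi.smul_apply, smul_eq_mul, mul_one]
      linarith)
    rw [map_neg, map_add, map_smul, smul_eq_mul] at this
    have h3 : (-w / (2 * F)) * F = -w / 2 := by field_simp
    change -(w + (-w / (2 * F)) * F) < 0 at this
    rw [h3] at this
    linarith
  have hone' : f (fun _ => 1) = ∑ i, f (Pi.single i 1) := by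
    rw [hfsum]; simp
  refine ⟨fun i => f (Pi.single i 1) / f (fun _ => 1), fun i => div_nonneg (hw i) hone.le, ?_, ?_⟩
  · rw [← Finset.sum_div, ← hone', div_self hone.ne']
  · intro h
    have hm : (fun i => A * ‖h i‖^2 - qf n v h) ∈ W :=
      ⟨Unit, inferInstance, fun _ => h, fun i => by simp⟩
    have h0 := hc0'.trans (hfW _ hm)
    rw [hfsum] at h0
    have h1 : ∑ i, (A * ‖h i‖^2 - qf n v h) * f (Pi.single i 1)
        = A * ∑ i, f (Pi.single i 1) * ‖h i‖^2 - qf n v h * f (fun _ => 1) := by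
      rw [hone', Finset.mul_sum, Finset.mul_sum, ← Finset.sum_sub_distrib]
      exact Finset.sum_congr rfl fun i _ => by ring
    rw [h1] at h0
    have h2 : ∑ i, f (Pi.single i 1) / f (fun _ => 1) * ‖h i‖^2
        = (∑ i, f (Pi.single i 1) * ‖h i‖^2) / f (fun _ => 1) := by
      rw [Finset.sum_div]
      exact Finset.sum_congr rfl fun i _ => by ring
    rw [h2, ← mul_div_assoc, le_div_iff₀ hone]
    linarith


lemma pointwise_bd (p q l L d x y : ℝ) (hp : 0 ≤ p) (hq : 0 ≤ q) (hl : 0 < l)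
    (hL : 0 ≤ L) (hd : 0 ≤ d) (hx : x = 0 ∨ x = 1) (hy : y = 0 ∨ y = 1)
    (hxq : x = 0 → q^2 ≤ L) (hyp : y = 0 → p^2 ≤ L) :
    p * q ≤ x * (l * p^2 + q^2 / l) / 2 + y * (l * q^2 + p^2 / l) / 2
      + (d * p + L * (if d ≤ p then 1 else 0)) / 2 + (d * q + L * (if d ≤ q then 1 else 0)) / 2 := by
  have amgm : ∀ a b : ℝ, a * b ≤ (l * a^2 + b^2 / l) / 2 := by
    intro a b
    have : (l * a^2 + b^2 / l) / 2 - a * b = (l * a - b)^2 / (2 * l) := by field_simp; ring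
    have h2 : 0 ≤ (l * a - b)^2 / (2 * l) := by positivity
    linarith
  have hA : ∀ p : ℝ, 0 ≤ p → 0 ≤ d * p + L * (if d ≤ p then 1 else 0) := by
    intro p hp; split_ifs <;> positivity
  have hB : ∀ p : ℝ, 0 ≤ p → p^2 ≤ L → p^2 ≤ d * p + L * (if d ≤ p then 1 else 0) := by
    intro p hp h
    split_ifs with h1
    · nlinarith [mul_nonneg hd hp]
    · push Not at h1; nlinarith
  have n1 : 0 ≤ l * p^2 + q^2 / l := by positivity
  have n2 : 0 ≤ l * q^2 + p^2 / l := by positivity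
  have a1 := hA p hp
  have a2 := hA q hq
  rcases hx with rfl | rfl
  · rcases hy with rfl | rfl
    · have := hB p hp (hyp rfl)
      have := hB q hq (hxq rfl)
      nlinarith [sq_nonneg (p - q)]
    · have := amgm q p
      linarith
  · have := amgm p q
    rcases hy with rfl | rfl <;> linarith

lemma key_interval {ι : Type} [Fintype ι] (μ : ι → ℝ) (hμ : ∀ i, 0 ≤ μ i)
    (g φ : ℕ → ι → ℂ) (I : Finset ℕ) (hI : 0 < I.card) (B C K : ℝ) (hB1 : 1 ≤ B) (hC1 : 1 ≤ C)
    (hK1 : 1 ≤ K) (hB : ∀ k i, ‖g k i‖ ≤ B)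
    (hdual : ∀ a : ℕ → ℂ, ∑ j, μ j * ‖∑ k ∈ I, a k * φ k j‖^2 ≤ C * ∑ k ∈ I, ‖a k‖^2)
    (hφ : ∀ k ∈ I, ∑ j, μ j * ‖φ k j‖^2 ≤ C)
    (hμ1 : ∑ i, μ i = 1)
    (D : ι → ι → ℂ) (hD : ∀ i j, D i j = ∑ k ∈ I, g k i * φ k j)
    (hZ : 3 * (I.card : ℝ) / 4 ≤ ‖∑ i, ∑ j, (μ i * μ j : ℂ) * (D i j * D j i)‖)
    (hL1 : ∑ i, ∑ j, μ i * μ j * ‖D i j‖ ≤ 2 * K) :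
    1 / (256 * B^6 * C^4) ≤ I.card *
      ∑ i, ∑ j, μ i * μ j * (if 1 / (8 * K) * I.card ≤ ‖D i j‖ then 1 else 0) := by
  classical
  have hℓ0' : 0 < (I.card : ℝ) := by exact_mod_cast hI
  obtain ⟨ℓ, hℓ⟩ : ∃ ℓ : ℝ, ℓ = (I.card : ℝ) := ⟨_, rfl⟩
  rw [← hℓ] at hZ hℓ0' ⊢
  have hℓ0 : 0 < ℓ := hℓ0'
  obtain ⟨lam, hlam⟩ : ∃ lam : ℝ, lam = 8 * C^2 * B^2 := ⟨_, rfl⟩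
  have hlam0 : 0 < lam := by rw [hlam]; positivity
  obtain ⟨d, hd⟩ : ∃ d : ℝ, d = 1 / (8 * K) * ℓ := ⟨_, rfl⟩
  rw [← hd]
  have hd0 : 0 < d := by rw [hd]; positivity
  obtain ⟨L, hL⟩ : ∃ L : ℝ, L = (B * lam * ℓ)^2 := ⟨_, rfl⟩
  let Φ : ι → ℝ := fun j => ∑ k ∈ I, ‖φ k j‖
  let χ : ι → ℝ := fun j => if lam * ℓ < Φ j then 1 else 0
  have hχ01 : ∀ j, χ j = 0 ∨ χ j = 1 := by
    intro j; simp only [χ]; split_ifs <;> simp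
  have hχD : ∀ i j, χ j = 0 → ‖D i j‖^2 ≤ L := by
    intro i j h
    have h1 : Φ j ≤ lam * ℓ := by
      by_contra hc
      push Not at hc
      simp [χ, hc] at h
    have : ‖D i j‖ ≤ B * lam * ℓ := by
      rw [hD]
      calc ‖∑ k ∈ I, g k i * φ k j‖ ≤ ∑ k ∈ I, B * ‖φ k j‖ := by
            refine (norm_sum_le _ _).trans (Finset.sum_le_sum fun k _ => ?_)
            rw [norm_mul]; gcongr; exact hB k i
        _ = B * Φ j := by rw [← Finset.mul_sum]
        _ ≤ B * (lam * ℓ) := by gcongr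
        _ = _ := by ring
    rw [hL]; gcongr
  -- measure of the exceptional set
  have hS : lam^2 * ∑ j, μ j * χ j ≤ C := by
    have h1 : ∀ j, (lam * ℓ)^2 * χ j ≤ ℓ * ∑ k ∈ I, ‖φ k j‖^2 := by
      intro j
      have hcs : Φ j ^2 ≤ ℓ * ∑ k ∈ I, ‖φ k j‖^2 := by
        rw [hℓ]; exact sq_sum_le_card_mul_sum_sq
      simp only [χ]
      split_ifs with h
      · refine le_trans ?_ hcs
        rw [mul_one]
        gcongr
      · rw [mul_zero]; positivity
    have h2 : (lam * ℓ)^2 * ∑ j, μ j * χ j ≤ ℓ * (ℓ * C) := by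
      calc (lam * ℓ)^2 * ∑ j, μ j * χ j = ∑ j, μ j * ((lam * ℓ)^2 * χ j) := by
            rw [Finset.mul_sum]; exact Finset.sum_congr rfl fun j _ => by ring
        _ ≤ ∑ j, μ j * (ℓ * ∑ k ∈ I, ‖φ k j‖^2) :=
            Finset.sum_le_sum fun j _ => mul_le_mul_of_nonneg_left (h1 j) (hμ j)
        _ = ℓ * ∑ k ∈ I, ∑ j, μ j * ‖φ k j‖^2 := by
            rw [Finset.sum_comm, Finset.mul_sum]
            refine Finset.sum_congr rfl fun j _ => ?_
            rw [← Finset.mul_sum]; ring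
        _ ≤ ℓ * ∑ k ∈ I, C := by gcongr with k hk; exact hφ k hk
        _ = _ := by simp [hℓ]
    have h3 : ℓ^2 * (lam^2 * ∑ j, μ j * χ j) ≤ ℓ^2 * C := by nlinarith
    exact le_of_mul_le_mul_left h3 (by positivity)
  -- row L2 bound
  have hrow : ∀ i, ∑ j, μ j * ‖D i j‖^2 ≤ C * B^2 * ℓ := by
    intro i
    simp_rw [hD]
    refine (hdual (fun k => g k i)).trans ?_
    rw [mul_assoc]
    gcongr
    calc ∑ k ∈ I, ‖g k i‖^2 ≤ ∑ k ∈ I, B^2 := by gcongr; exact hB _ _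
      _ = B^2 * ℓ := by simp [hℓ]; ring
  let P : (ι → ι → ℝ) → ℝ := fun F => ∑ i, ∑ j, μ i * μ j * F i j
  have Padd : ∀ F G, P (fun i j => F i j + G i j) = P F + P G := by
    intro F G; simp only [P, mul_add, Finset.sum_add_distrib]
  have Pmul : ∀ (c : ℝ) F, P (fun i j => c * F i j) = c * P F := by
    intro c F; simp only [P, Finset.mul_sum]
    exact Finset.sum_congr rfl fun i _ => Finset.sum_congr rfl fun j _ => by ring
  have Pswap : ∀ F : ι → ι → ℝ, P (fun i j => F j i) = P F := by
    intro F; simp only [P]; rw [Finset.sum_comm]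
    exact Finset.sum_congr rfl fun i _ => Finset.sum_congr rfl fun j _ => by ring
  have Pmono : ∀ F G : ι → ι → ℝ, (∀ i j, F i j ≤ G i j) → P F ≤ P G := by
    intro F G h
    exact Finset.sum_le_sum fun i _ => Finset.sum_le_sum fun j _ =>
      mul_le_mul_of_nonneg_left (h i j) (mul_nonneg (hμ i) (hμ j))
  let ind : ι → ι → ℝ := fun i j => if d ≤ ‖D i j‖ then 1 else 0
  have hZP : 3 * ℓ / 4 ≤ P (fun i j => ‖D i j‖ * ‖D j i‖) := by
    refine hZ.trans ?_
    refine (norm_sum_le _ _).trans (Finset.sum_le_sum fun i _ => ?_)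
    refine (norm_sum_le _ _).trans (Finset.sum_le_sum fun j _ => ?_)
    simp [abs_of_nonneg (hμ i), abs_of_nonneg (hμ j)]
  let F1 : ι → ι → ℝ := fun i j => χ i * ‖D i j‖^2
  let F2 : ι → ι → ℝ := fun i j => ‖D i j‖^2
  let F3 : ι → ι → ℝ := fun i j => ‖D i j‖
  have hpt : ∀ i j, ‖D i j‖ * ‖D j i‖ ≤ (lam/2) * F1 i j + ((1/(2*lam)) * F2 j i +
      ((lam/2) * F1 j i + ((1/(2*lam)) * F2 i j + ((d/2) * F3 i j + ((L/2) * ind i j +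
      ((d/2) * F3 j i + (L/2) * ind j i)))))) := by
    intro i j
    have h := pointwise_bd ‖D i j‖ ‖D j i‖ lam L d (χ i) (χ j) (norm_nonneg _) (norm_nonneg _)
      hlam0 (by rw [hL]; positivity) hd0.le (hχ01 i) (hχ01 j) (hχD j i) (hχD i j)
    refine h.trans ?_
    have e1 : χ i * ‖D j i‖^2 ≤ ‖D j i‖^2 := by
      rcases hχ01 i with h | h <;> rw [h] <;> nlinarith [sq_nonneg ‖D j i‖]
    have e2 : χ j * ‖D i j‖^2 ≤ ‖D i j‖^2 := by
      rcases hχ01 j with h | h <;> rw [h] <;> nlinarith [sq_nonneg ‖D i j‖]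
    have e3 : (1/(2*lam)) * (χ i * ‖D j i‖^2) ≤ (1/(2*lam)) * ‖D j i‖^2 := by gcongr
    have e4 : (1/(2*lam)) * (χ j * ‖D i j‖^2) ≤ (1/(2*lam)) * ‖D i j‖^2 := by gcongr
    have e5 : χ i * (lam * ‖D i j‖^2 + ‖D j i‖^2 / lam) / 2
      = (lam/2) * (χ i * ‖D i j‖^2) + (1/(2*lam)) * (χ i * ‖D j i‖^2) := by field_simp
    have e6 : χ j * (lam * ‖D j i‖^2 + ‖D i j‖^2 / lam) / 2
      = (lam/2) * (χ j * ‖D j i‖^2) + (1/(2*lam)) * (χ j * ‖D i j‖^2) := by field_simp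
    rw [e5, e6]
    simp only [F1, F2, F3, ind]
    linarith
  have hsum := hZP.trans (Pmono _ _ hpt)
  rw [Padd, Padd, Padd, Padd, Padd, Padd, Padd] at hsum
  simp only [Pmul] at hsum
  rw [Pswap F1, Pswap F2, Pswap F3, Pswap ind] at hsum
  have hF1 : P F1 ≤ C * B^2 * ℓ * ∑ i, μ i * χ i := by
    simp only [P, F1]
    rw [Finset.mul_sum]
    refine Finset.sum_le_sum fun i _ => ?_
    have hx : 0 ≤ χ i := by rcases hχ01 i with h | h <;> rw [h]; norm_num
    calc ∑ j, μ i * μ j * (χ i * ‖D i j‖^2) = μ i * χ i * ∑ j, μ j * ‖D i j‖^2 := by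
          rw [Finset.mul_sum]; exact Finset.sum_congr rfl fun j _ => by ring
      _ ≤ μ i * χ i * (C * B^2 * ℓ) :=
          mul_le_mul_of_nonneg_left (hrow i) (mul_nonneg (hμ i) hx)
      _ = _ := by ring
  have hF2 : P F2 ≤ C * B^2 * ℓ := by
    simp only [P, F2]
    calc ∑ i, ∑ j, μ i * μ j * ‖D i j‖^2 = ∑ i, μ i * ∑ j, μ j * ‖D i j‖^2 := by
          refine Finset.sum_congr rfl fun i _ => ?_
          rw [Finset.mul_sum]; exact Finset.sum_congr rfl fun j _ => by ring
      _ ≤ ∑ i, μ i * (C * B^2 * ℓ) :=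
          Finset.sum_le_sum fun i _ => mul_le_mul_of_nonneg_left (hrow i) (hμ i)
      _ = _ := by rw [← Finset.sum_mul, hμ1, one_mul]
  have hF3 : P F3 ≤ 2 * K := hL1
  have b1 : lam * P F1 ≤ ℓ / 8 := by
    have : lam * (lam * P F1) ≤ lam * (ℓ / 8) := by
      calc lam * (lam * P F1) = lam^2 * P F1 := by ring
        _ ≤ lam^2 * (C * B^2 * ℓ * ∑ i, μ i * χ i) := by gcongr
        _ = C * B^2 * ℓ * (lam^2 * ∑ i, μ i * χ i) := by ring
        _ ≤ C * B^2 * ℓ * C := by gcongr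
        _ = lam * (ℓ / 8) := by rw [hlam]; ring
    exact le_of_mul_le_mul_left this hlam0
  have b2 : (1/lam) * P F2 ≤ ℓ / 8 := by
    rw [one_div, inv_mul_le_iff₀ hlam0, hlam]
    refine hF2.trans ?_
    have : C ≤ C^2 := by nlinarith
    calc C * B^2 * ℓ ≤ C^2 * B^2 * ℓ := by gcongr
      _ = _ := by ring
  have b3 : d * P F3 ≤ ℓ / 4 := by
    calc d * P F3 ≤ d * (2 * K) := by gcongr
      _ = ℓ / 4 := by rw [hd]; field_simp; norm_num
  have b4 : ℓ / 4 ≤ L * P ind := by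
    have : (1/(2*lam)) * P F2 = (1/lam) * P F2 / 2 := by field_simp
    rw [this] at hsum
    linarith
  change 1 / (256 * B^6 * C^4) ≤ ℓ * P ind
  rw [div_le_iff₀ (by positivity)]
  have e : L * P ind = (ℓ / 4) * (ℓ * P ind * (256 * B^6 * C^4)) := by
    rw [hL, hlam]; ring
  rw [e] at b4
  have : (ℓ/4) * 1 ≤ (ℓ / 4) * (ℓ * P ind * (256 * B^6 * C^4)) := by linarith
  exact le_of_mul_le_mul_left this (by positivity)

/-- dyadic layer cake -/
lemma layer (r : ℕ) (x : ℝ) (hx : 0 ≤ x) :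
    ∑ j ∈ range r, (2:ℝ)^j * (if (2:ℝ)^j ≤ x then 1 else 0) ≤ 2 * x := by
  induction r with
  | zero => simpa using hx
  | succ r ih =>
    by_cases h : (2:ℝ)^r ≤ x
    · calc _ ≤ ∑ j ∈ range (r+1), (2:ℝ)^j := by
            refine Finset.sum_le_sum fun j _ => ?_
            split_ifs <;> simp
        _ = 2^(r+1) - 1 := by rw [geom_sum_eq (by norm_num)]; norm_num
        _ ≤ 2 * x := by rw [pow_succ]; linarith
    · rw [Finset.sum_range_succ, if_neg h]; simpa using ih

/-- averaging argument -/
lemma averaging {ι : Type} [Fintype ι] (μ : ι → ℝ) (hμ : ∀ i, 0 ≤ μ i)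
    (r : ℕ) (D : ℕ → ι → ι → ℂ) (K δ κ : ℝ) (hδ : 0 < δ) 
    (hL1 : ∀ m < 2 * 2^r, ∑ i, ∑ j, μ i * μ j * ‖D m i j‖ ≤ K)
    (hlow : ∀ s < r, ∀ m < 2^r, κ ≤ (2:ℝ)^s *
      ∑ i, ∑ j, μ i * μ j * (if δ * 2^s ≤ ‖D (m + 2^s) i j - D m i j‖ then 1 else 0)) :
    r * κ ≤ 16 * K / δ := by
  let a : ℕ → ℕ → ℝ := fun s m =>
    (2:ℝ)^s * ∑ i, ∑ j, μ i * μ j * (if (2:ℝ)^s ≤ 2 / δ * ‖D m i j‖ then 1 else 0)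
  have ha0 : ∀ s m, 0 ≤ a s m := by
    intro s m
    refine mul_nonneg (by positivity) (Finset.sum_nonneg fun i _ => Finset.sum_nonneg fun j _ => ?_)
    refine mul_nonneg (mul_nonneg (hμ i) (hμ j)) (by split_ifs <;> norm_num)
  have hpair : ∀ s < r, ∀ m < 2^r, κ ≤ a s (m + 2^s) + a s m := by
    intro s hs m hm
    refine (hlow s hs m hm).trans ?_
    simp only [a]
    rw [← mul_add, ← Finset.sum_add_distrib]
    refine mul_le_mul_of_nonneg_left (Finset.sum_le_sum fun i _ => ?_) (by positivity)
    rw [← Finset.sum_add_distrib]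
    refine Finset.sum_le_sum fun j _ => ?_
    rw [← mul_add]
    refine mul_le_mul_of_nonneg_left ?_ (mul_nonneg (hμ i) (hμ j))
    by_cases h : δ * 2^s ≤ ‖D (m + 2^s) i j - D m i j‖
    · have h1 := h.trans (norm_sub_le _ _)
      have h2 : (2:ℝ)^s ≤ 2 / δ * ‖D (m + 2^s) i j‖ ∨ (2:ℝ)^s ≤ 2 / δ * ‖D m i j‖ := by
        by_contra hc
        push Not at hc
        obtain ⟨c1, c2⟩ := hc
        rw [div_mul_eq_mul_div, div_lt_iff₀ hδ] at c1 c2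
        linarith
      rw [if_pos h]
      rcases h2 with h2 | h2
      · rw [if_pos h2]; split_ifs <;> norm_num
      · rw [if_pos h2]; split_ifs <;> norm_num
    · rw [if_neg h]; split_ifs <;> norm_num
  have hup : ∀ m < 2 * 2^r, ∑ s ∈ range r, a s m ≤ 4 * K / δ := by
    intro m hm
    calc ∑ s ∈ range r, a s m = ∑ i, ∑ j, μ i * μ j *
          ∑ s ∈ range r, (2:ℝ)^s * (if (2:ℝ)^s ≤ 2 / δ * ‖D m i j‖ then 1 else 0) := by
          simp only [a, Finset.mul_sum]
          rw [Finset.sum_comm]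
          refine Finset.sum_congr rfl fun i _ => ?_
          rw [Finset.sum_comm]
          exact Finset.sum_congr rfl fun j _ => Finset.sum_congr rfl fun s _ => by ring
      _ ≤ ∑ i, ∑ j, μ i * μ j * (2 * (2 / δ * ‖D m i j‖)) := by
          refine Finset.sum_le_sum fun i _ => Finset.sum_le_sum fun j _ => ?_
          exact mul_le_mul_of_nonneg_left (layer r _ (by positivity)) (mul_nonneg (hμ i) (hμ j))
      _ = 4 / δ * ∑ i, ∑ j, μ i * μ j * ‖D m i j‖ := by
          simp only [Finset.mul_sum]
          exact Finset.sum_congr rfl fun i _ => Finset.sum_congr rfl fun j _ => by ring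
      _ ≤ 4 / δ * K := by gcongr; exact hL1 m hm
      _ = _ := by ring
  have hsm : ∀ s < r, (2:ℝ)^r * κ ≤ 2 * ∑ m ∈ range (2 * 2^r), a s m := by
    intro s hs
    have hss : 2^s ≤ 2^r := Nat.pow_le_pow_right (by norm_num) hs.le
    have h1 : ∑ m ∈ range (2^r), a s m ≤ ∑ m ∈ range (2 * 2^r), a s m :=
      Finset.sum_le_sum_of_subset_of_nonneg (Finset.range_mono (by omega)) (fun _ _ _ => ha0 _ _)
    have h2 : ∑ m ∈ range (2^r), a s (m + 2^s) ≤ ∑ m ∈ range (2 * 2^r), a s m := by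
      have : ∑ m ∈ range (2^r), a s (m + 2^s) = ∑ m ∈ (range (2^r)).image (· + 2^s), a s m := by
        rw [Finset.sum_image]
        intro x _ y _ h
        simpa using h
      rw [this]
      refine Finset.sum_le_sum_of_subset_of_nonneg ?_ (fun _ _ _ => ha0 _ _)
      intro x hx
      simp only [Finset.mem_image, Finset.mem_range] at hx ⊢
      obtain ⟨y, hy, rfl⟩ := hx
      omega
    have h3 : ∑ m ∈ range (2^r), κ ≤ ∑ m ∈ range (2^r), (a s (m + 2^s) + a s m) :=
      Finset.sum_le_sum fun m hm => hpair s hs m (Finset.mem_range.1 hm)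
    rw [Finset.sum_add_distrib] at h3
    simp only [Finset.sum_const, Finset.card_range, nsmul_eq_mul, Nat.cast_pow, Nat.cast_ofNat] at h3
    linarith
  have h1 : ∑ s ∈ range r, (2:ℝ)^r * κ ≤ ∑ s ∈ range r, 2 * ∑ m ∈ range (2 * 2^r), a s m :=
    Finset.sum_le_sum fun s hs => hsm s (Finset.mem_range.1 hs)
  rw [← Finset.mul_sum, ← Finset.mul_sum, Finset.sum_comm (s := range r)] at h1
  have h2 : ∑ m ∈ range (2 * 2^r), ∑ s ∈ range r, a s m ≤ ∑ m ∈ range (2 * 2^r), 4 * K / δ :=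
    Finset.sum_le_sum fun m hm => hup m (Finset.mem_range.1 hm)
  simp only [Finset.sum_const, Finset.card_range, nsmul_eq_mul, Nat.cast_mul, Nat.cast_pow,
    Nat.cast_ofNat] at h1 h2
  have h3 : (2:ℝ)^r * (r * κ) ≤ 2^r * (16 * K / δ) := by
    have : 16 * K / δ = 4 * (4 * K / δ) := by ring
    rw [this]
    nlinarith
  exact le_of_mul_le_mul_left h3 (by positivity)


lemma norm_phase (w : ℂ) : ∃ h : ℂ, ‖h‖ ≤ 1 ∧ w * h = ‖w‖ := by
  by_cases hw : w = 0
  · exact ⟨0, by simp, by simp [hw]⟩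
  · have hn : (‖w‖ : ℂ) ≠ 0 := by simpa using hw
    refine ⟨(starRingEnd ℂ) w / ‖w‖, by simp [hw], ?_⟩
    rw [← mul_div_assoc, Complex.mul_conj, Complex.normSq_eq_norm_sq]
    push_cast
    field_simp

lemma dual_bessel {ι : Type} [Fintype ι] (μ : ι → ℝ) (hμ : ∀ i, 0 < μ i) (n : ℕ)
    (v : ℕ → ι → ℂ) (C : ℝ) (hC : 0 ≤ C)
    (hq : ∀ h, qf n v h ≤ C * ∑ i, μ i * ‖h i‖^2) (I : Finset ℕ) (hI : I ⊆ range n) (a : ℕ → ℂ) :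
    ∑ j, μ j * ‖∑ k ∈ I, a k * (v k j / μ j)‖^2 ≤ C * ∑ k ∈ I, ‖a k‖^2 := by
  set F : ι → ℂ := fun j => ∑ k ∈ I, a k * (v k j / μ j) with hF
  set X : ℝ := ∑ j, μ j * ‖F j‖^2 with hX
  have hX0 : 0 ≤ X := Finset.sum_nonneg fun j _ => mul_nonneg (hμ j).le (by positivity)
  let G : ι → ℂ := fun j => (starRingEnd ℂ) (F j)
  have h1 : (X : ℂ) = ∑ k ∈ I, a k * ∑ j, v k j * G j := by
    rw [hX]
    push_cast
    simp_rw [Finset.mul_sum]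
    rw [Finset.sum_comm]
    refine Finset.sum_congr rfl fun j _ => ?_
    have : ((‖F j‖ : ℂ))^2 = F j * G j := by
      rw [Complex.mul_conj, Complex.normSq_eq_norm_sq]; push_cast; rfl
    rw [this]
    have hm : (μ j : ℂ) ≠ 0 := by exact_mod_cast (hμ j).ne'
    conv_lhs => rw [← mul_assoc, hF]
    rw [Finset.mul_sum, Finset.sum_mul]
    refine Finset.sum_congr rfl fun k _ => ?_
    field_simp
  have h2 : X ≤ ∑ k ∈ I, ‖a k‖ * ‖∑ j, v k j * G j‖ := by
    have : X = ‖(X : ℂ)‖ := by simp [abs_of_nonneg hX0]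
    rw [this, h1]
    refine (norm_sum_le _ _).trans (le_of_eq ?_)
    simp
  have h3 : X^2 ≤ (∑ k ∈ I, ‖a k‖^2) * (C * X) := by
    calc X^2 ≤ (∑ k ∈ I, ‖a k‖ * ‖∑ j, v k j * G j‖)^2 := by gcongr
      _ ≤ (∑ k ∈ I, ‖a k‖^2) * ∑ k ∈ I, ‖∑ j, v k j * G j‖^2 := Finset.sum_mul_sq_le_sq_mul_sq _ _ _
      _ ≤ (∑ k ∈ I, ‖a k‖^2) * (C * X) := by
        gcongr
        refine le_trans (Finset.sum_le_sum_of_subset_of_nonneg hI (fun _ _ _ => by positivity)) ?_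
        refine (hq G).trans (le_of_eq ?_)
        simp [G, hX]
  rcases hX0.eq_or_lt with h | h
  · rw [← h]; positivity
  · have : X * X ≤ X * (C * ∑ k ∈ I, ‖a k‖^2) := by nlinarith
    exact le_of_mul_le_mul_left this h

lemma finite_main {ι : Type} [Fintype ι] [Nonempty ι] (r : ℕ) (v g : ℕ → ι → ℂ)
    (B C0 K : ℝ) (hB1 : 1 ≤ B) (hC1 : 1 ≤ C0) (hK1 : 1 ≤ K)
    (hB : ∀ k i, ‖g k i‖ ≤ B)
    (hT : ∀ m (h : ι → ℂ), (∀ j, ‖h j‖ ≤ 1) → ∀ i,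
      ‖∑ k ∈ range m, (∑ j, v k j * h j) * g k i‖ ≤ K)
    (hC : ∀ (h : ι → ℂ) (ρ : ℝ), 0 ≤ ρ → (∀ i, ‖h i‖ ≤ ρ) → qf (2 * 2^r) v h ≤ C0 * ρ^2)
    (hbi : ∀ k < 2 * 2^r, ∀ l < 2 * 2^r,
      ‖∑ j, v k j * g l j - (if k = l then 1 else 0)‖ ≤ 1 / (12 * (2 * 2^r))) :
    r * (1 / (256 * B^6 * (98 * C0)^4)) ≤ 16 * K / (1 / (8 * K)) := by
  classical
  obtain ⟨μ0, hμ0, hμ1, hq0⟩ := pietsch (2 * 2^r) v (49 * C0) (by positivity)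
    (summing_final _ v C0 (by linarith) hC)
  let c : ℝ := Fintype.card ι
  have hc : 0 < c := by simp only [c]; exact_mod_cast Fintype.card_pos
  obtain ⟨μ, hμ⟩ : ∃ μ : ι → ℝ, ∀ i, μ i = (μ0 i + 1 / c) / 2 := ⟨_, fun i => rfl⟩
  have hμpos : ∀ i, 0 < μ i := by
    intro i; rw [hμ]
    have := hμ0 i
    positivity
  have hμs : ∑ i, μ i = 1 := by
    simp_rw [hμ, ← Finset.sum_div, Finset.sum_add_distrib, hμ1]
    simp only [Finset.sum_const, Finset.card_univ, nsmul_eq_mul]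
    change (1 + c * (1 / c)) / 2 = 1
    field_simp; norm_num
  have hq : ∀ h, qf (2 * 2^r) v h ≤ (98 * C0) * ∑ i, μ i * ‖h i‖^2 := by
    intro h
    refine (hq0 h).trans ?_
    have : ∑ i, μ0 i * ‖h i‖^2 ≤ 2 * ∑ i, μ i * ‖h i‖^2 := by
      rw [Finset.mul_sum]
      refine Finset.sum_le_sum fun i _ => ?_
      rw [hμ, ← mul_assoc]
      gcongr
      have : 0 < 1 / c := by positivity
      linarith
    nlinarith
  let φ : ℕ → ι → ℂ := fun k j => v k j / μ j
  have hφv : ∀ k j, (μ j : ℂ) * φ k j = v k j := by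
    intro k j
    have hm : (μ j : ℂ) ≠ 0 := by exact_mod_cast (hμpos j).ne'
    simp only [φ]; field_simp
  let D : ℕ → ι → ι → ℂ := fun m i j => ∑ k ∈ range m, g k i * φ k j
  have hrowL1 : ∀ m i, ∑ j, μ j * ‖D m i j‖ ≤ K := by
    intro m i
    let w : ι → ℂ := fun j => ∑ k ∈ range m, g k i * v k j
    have h1 : ∀ j, μ j * ‖D m i j‖ = ‖w j‖ := by
      intro j
      have : w j = μ j * D m i j := by
        simp only [w, D, Finset.mul_sum]
        refine Finset.sum_congr rfl fun k _ => ?_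
        rw [← hφv]; ring
      rw [this, norm_mul]; simp [abs_of_pos (hμpos j)]
    choose h hh1 hh2 using fun j => norm_phase (w j)
    have h3 := hT m h hh1 i
    have h4 : ∑ k ∈ range m, (∑ j, v k j * h j) * g k i = ((∑ j, ‖w j‖ : ℝ) : ℂ) := by
      push_cast
      simp_rw [← hh2, w, Finset.sum_mul]
      rw [Finset.sum_comm]
      exact Finset.sum_congr rfl fun j _ => Finset.sum_congr rfl fun k _ => by ring
    rw [h4, Complex.norm_real, Real.norm_of_nonneg (by positivity)] at h3
    simp_rw [h1]
    exact h3
  have hL1 : ∀ m, ∑ i, ∑ j, μ i * μ j * ‖D m i j‖ ≤ K := by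
    intro m
    calc ∑ i, ∑ j, μ i * μ j * ‖D m i j‖ = ∑ i, μ i * ∑ j, μ j * ‖D m i j‖ := by
          refine Finset.sum_congr rfl fun i _ => ?_
          rw [Finset.mul_sum]; exact Finset.sum_congr rfl fun j _ => by ring
      _ ≤ ∑ i, μ i * K :=
          Finset.sum_le_sum fun i _ => mul_le_mul_of_nonneg_left (hrowL1 m i) (hμpos i).le
      _ = K := by rw [← Finset.sum_mul, hμs, one_mul]
  refine averaging μ (fun i => (hμpos i).le) r D K (1 / (8 * K)) _ (by positivity)
    (fun m _ => hL1 m) ?_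
  intro s hs m hm
  have hss : 2 * 2^s ≤ 2^r := by
    rw [← pow_succ']
    exact Nat.pow_le_pow_right (by norm_num) hs
  let I : Finset ℕ := Finset.Ico m (m + 2^s)
  have hIcard : I.card = 2^s := by simp [I]
  have hIsub : I ⊆ range (2 * 2^r) := by
    intro x hx
    simp only [I, Finset.mem_Ico, Finset.mem_range] at hx ⊢
    omega
  have hDI : ∀ i j, D (m + 2^s) i j - D m i j = ∑ k ∈ I, g k i * φ k j := by
    intro i j
    simp only [D, I]
    rw [Finset.sum_Ico_eq_sub _ (by omega)]
  have hdual := dual_bessel μ hμpos (2 * 2^r) v (98 * C0) (by positivity) hq I hIsub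
  have key := key_interval μ (fun i => (hμpos i).le) g φ I (by rw [hIcard]; positivity)
    B (98 * C0) K hB1 (by linarith) hK1 hB hdual ?_ hμs
    (fun i j => D (m + 2^s) i j - D m i j) hDI ?_ ?_
  · rw [hIcard] at key
    push_cast at key
    exact key
  · intro k hk
    have := hdual (fun l => if l = k then 1 else 0)
    have e1 : ∑ l ∈ I, ‖(if l = k then 1 else 0 : ℂ)‖^2 = 1 := by
      rw [Finset.sum_eq_single k (fun b _ hb => by simp [hb]) (fun h => absurd hk h)]
      simp
    have e2 : ∀ j, ∑ l ∈ I, (if l = k then 1 else 0 : ℂ) * (v l j / μ j) = φ k j := by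
      intro j
      rw [Finset.sum_eq_single k (fun b _ hb => by simp [hb]) (fun h => absurd hk h)]
      simp [φ]
    simp only [e1, e2, mul_one] at this
    exact this
  · -- trace
    let x : ℕ → ℕ → ℂ := fun k l => ∑ j, v k j * g l j
    have hZ : ∑ i, ∑ j, (μ i * μ j : ℂ) *
        ((D (m + 2^s) i j - D m i j) * (D (m + 2^s) j i - D m j i))
        = ∑ k ∈ I, ∑ l ∈ I, x k l * x l k := by
      have e1 : ∀ i j, (μ i * μ j : ℂ) *
        ((D (m + 2^s) i j - D m i j) * (D (m + 2^s) j i - D m j i))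
        = ∑ k ∈ I, ∑ l ∈ I, (v k j * g l j) * (v l i * g k i) := by
        intro i j
        rw [hDI, hDI, Finset.sum_mul_sum, Finset.mul_sum]
        refine Finset.sum_congr rfl fun k _ => ?_
        rw [Finset.mul_sum]
        refine Finset.sum_congr rfl fun l _ => ?_
        rw [← hφv k j, ← hφv l i]; ring
      simp_rw [e1, x, Finset.sum_mul_sum]
      rw [Finset.sum_comm]
      calc _ = ∑ j, ∑ k ∈ I, ∑ i, ∑ l ∈ I, (v k j * g l j) * (v l i * g k i) :=
            Finset.sum_congr rfl fun j _ => Finset.sum_comm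
        _ = ∑ k ∈ I, ∑ j, ∑ i, ∑ l ∈ I, (v k j * g l j) * (v l i * g k i) := Finset.sum_comm
        _ = ∑ k ∈ I, ∑ j, ∑ l ∈ I, ∑ i, (v k j * g l j) * (v l i * g k i) :=
            Finset.sum_congr rfl fun k _ => Finset.sum_congr rfl fun j _ => Finset.sum_comm
        _ = ∑ k ∈ I, ∑ l ∈ I, ∑ j, ∑ i, (v k j * g l j) * (v l i * g k i) :=
            Finset.sum_congr rfl fun k _ => Finset.sum_comm
    rw [hZ]
    set n : ℝ := 2 * 2^r with hn
    have hn1 : 1 ≤ n := by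
      have : (1:ℝ) ≤ 2^r := one_le_pow₀ (by norm_num)
      linarith
    have hε1 : 1 / (12 * n) ≤ 1 := by rw [div_le_one (by positivity)]; linarith
    have hxx : ∀ k ∈ I, ∀ l ∈ I, ‖x k l * x l k - (if k = l then 1 else 0)‖ ≤ 3 * (1 / (12 * n)) := by
      intro k hk l hl
      have a1 := hbi k (Finset.mem_range.1 (hIsub hk)) l (Finset.mem_range.1 (hIsub hl))
      have a2 := hbi l (Finset.mem_range.1 (hIsub hl)) k (Finset.mem_range.1 (hIsub hk))
      change ‖x k l - _‖ ≤ _ at a1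
      change ‖x l k - _‖ ≤ _ at a2
      set ε := 1 / (12 * n)
      have hε0 : 0 ≤ ε := by positivity
      by_cases h : k = l
      · subst h
        simp only [if_true] at a1 ⊢
        have : x k k * x k k - 1 = (x k k - 1) * (x k k - 1) + 2 * (x k k - 1) := by ring
        rw [this]
        refine (norm_add_le _ _).trans ?_
        rw [norm_mul, norm_mul]
        simp only [Complex.norm_ofNat]
        nlinarith [norm_nonneg (x k k - 1)]
      · rw [if_neg h, sub_zero] at a1
        rw [if_neg (Ne.symm h), sub_zero] at a2
        rw [if_neg h, sub_zero, norm_mul]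
        nlinarith [norm_nonneg (x k l), norm_nonneg (x l k)]
    have hsum : ∑ k ∈ I, ∑ l ∈ I, x k l * x l k
        = (I.card : ℂ) + ∑ k ∈ I, ∑ l ∈ I, (x k l * x l k - (if k = l then 1 else 0)) := by
      simp only [Finset.sum_sub_distrib, Finset.sum_ite_eq]
      simp
    have herr : ‖∑ k ∈ I, ∑ l ∈ I, (x k l * x l k - (if k = l then 1 else 0))‖ ≤ I.card / 4 := by
      calc _ ≤ ∑ k ∈ I, ∑ l ∈ I, 3 * (1 / (12 * n)) :=
            (norm_sum_le _ _).trans (Finset.sum_le_sum fun k hk =>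
              (norm_sum_le _ _).trans (Finset.sum_le_sum fun l hl => hxx k hk l hl))
        _ = I.card * (I.card / n) / 4 := by
            simp only [Finset.sum_const, nsmul_eq_mul]; field_simp; ring
        _ ≤ I.card * 1 / 4 := by
            gcongr
            rw [div_le_one (by positivity)]
            have := Finset.card_le_card hIsub
            rw [Finset.card_range] at this
            rw [hn]; exact_mod_cast this
        _ = _ := by ring
    rw [hsum]
    have := norm_sub_norm_le (I.card : ℂ)
      (-∑ k ∈ I, ∑ l ∈ I, (x k l * x l k - (if k = l then 1 else 0)))
    rw [sub_neg_eq_add, norm_neg, Complex.norm_natCast] at this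
    linarith
  · have : ∑ i, ∑ j, μ i * μ j * ‖D (m + 2^s) i j - D m i j‖
        ≤ ∑ i, ∑ j, (μ i * μ j * ‖D (m + 2^s) i j‖ + μ i * μ j * ‖D m i j‖) := by
      refine Finset.sum_le_sum fun i _ => Finset.sum_le_sum fun j _ => ?_
      rw [← mul_add]
      exact mul_le_mul_of_nonneg_left (norm_sub_le _ _) (mul_nonneg (hμpos i).le (hμpos j).le)
    refine this.trans ?_
    simp only [Finset.sum_add_distrib]
    linarith [hL1 (m + 2^s), hL1 m]


lemma discretize {X : Type} [MetricSpace X] [CompactSpace X] [Nonempty X]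
    (n : ℕ) (G : ℕ → C(X, ℂ)) (ε : ℝ) (hε : 0 < ε) :
    ∃ (ι : Type) (_ : Fintype ι) (_ : Nonempty ι) (x : ι → X) (p : ι → C(X, ℂ)),
      (∀ (h : ι → ℂ) (ρ : ℝ), (∀ i, ‖h i‖ ≤ ρ) → 0 ≤ ρ → ‖∑ i, h i • p i‖ ≤ ρ) ∧
      ∀ k < n, ‖∑ i, G k (x i) • p i - G k‖ ≤ ε := by
  -- uniform continuity
  have hδ : ∃ δ > 0, ∀ k < n, ∀ a b : X, dist a b < δ → ‖G k a - G k b‖ ≤ ε := by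
    have h1 : ∀ k, ∃ δ > 0, ∀ a b : X, dist a b < δ → ‖G k a - G k b‖ ≤ ε := by
      intro k
      have := CompactSpace.uniformContinuous_of_continuous (G k).continuous
      obtain ⟨δ, hδ, h⟩ := Metric.uniformContinuous_iff.1 this ε hε
      exact ⟨δ, hδ, fun a b hab => by rw [← dist_eq_norm]; exact (h hab).le⟩
    choose d hd0 hd using h1
    clear hε
    induction n with
    | zero => exact ⟨1, one_pos, by simp⟩
    | succ n ih =>
      obtain ⟨δ, hδ, h⟩ := ih
      refine ⟨min δ (d n), lt_min hδ (hd0 n), fun k hk a b hab => ?_⟩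
      rcases Nat.lt_succ_iff_lt_or_eq.1 hk with hk | rfl
      · exact h k hk a b (hab.trans_le (min_le_left _ _))
      · exact hd k a b (hab.trans_le (min_le_right _ _))
  obtain ⟨δ, hδ, hG⟩ := hδ
  obtain ⟨t, -, htf, ht⟩ := finite_cover_balls_of_compact (isCompact_univ (X := X)) hδ
  haveI : Fintype t := htf.fintype
  have hcov : (Set.univ : Set X) ⊆ ⋃ i : t, Metric.ball (i : X) δ := by
    intro y hy
    have := ht hy
    simp only [Set.mem_iUnion] at this ⊢
    obtain ⟨i, hi, hy⟩ := this
    exact ⟨⟨i, hi⟩, hy⟩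
  obtain ⟨P, hP⟩ := PartitionOfUnity.exists_isSubordinate isClosed_univ
    (fun i : t => Metric.ball (i : X) δ) (fun i => Metric.isOpen_ball) hcov
  have hne : Nonempty t := by
    obtain ⟨y⟩ := (inferInstance : Nonempty X)
    have := hcov (Set.mem_univ y)
    simp only [Set.mem_iUnion] at this
    exact ⟨this.choose⟩
  let p : t → C(X, ℂ) := fun i => ⟨fun y => ((P i y : ℝ) : ℂ), by fun_prop⟩
  have hsum : ∀ y, ∑ i, P i y = 1 := by
    intro y
    rw [← P.sum_eq_one (Set.mem_univ y), finsum_eq_sum_of_fintype]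
  refine ⟨t, inferInstance, hne, fun i => i, p, ?_, ?_⟩
  · intro h ρ hh hρ
    rw [ContinuousMap.norm_le _ hρ]
    intro y
    simp only [ContinuousMap.coe_sum, ContinuousMap.coe_smul, Finset.sum_apply, Pi.smul_apply, smul_eq_mul]
    calc ‖∑ i, h i * p i y‖ ≤ ∑ i, ρ * P i y := by
          refine (norm_sum_le _ _).trans (Finset.sum_le_sum fun i _ => ?_)
          rw [norm_mul]
          have : ‖p i y‖ = P i y := by simp [p, abs_of_nonneg (P.nonneg i y)]
          rw [this]
          exact mul_le_mul_of_nonneg_right (hh i) (P.nonneg i y)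
      _ = ρ := by rw [← Finset.mul_sum, hsum, mul_one]
  · intro k hk
    rw [ContinuousMap.norm_le _ hε.le]
    intro y
    simp only [ContinuousMap.sub_apply, ContinuousMap.coe_sum, ContinuousMap.coe_smul, Finset.sum_apply, Pi.smul_apply, smul_eq_mul]
    have e : G k y = ∑ i, G k y * p i y := by
      rw [← Finset.mul_sum]
      have : ∑ i, p i y = 1 := by
        have := hsum y
        simp only [p, ContinuousMap.coe_mk]
        exact_mod_cast this
      rw [this, mul_one]
    rw [e, ← Finset.sum_sub_distrib]
    calc _ ≤ ∑ i, ε * P i y := by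
          refine (norm_sum_le _ _).trans (Finset.sum_le_sum fun i _ => ?_)
          rw [← sub_mul, norm_mul]
          have : ‖p i y‖ = P i y := by simp [p, abs_of_nonneg (P.nonneg i y)]
          rw [this]
          by_cases h0 : P i y = 0
          · simp [h0]
          · refine mul_le_mul_of_nonneg_right ?_ (P.nonneg i y)
            refine hG k hk _ _ ?_
            have : y ∈ Metric.ball (i : X) δ := hP i (subset_tsupport _ h0)
            rw [dist_comm]; exact this
      _ = ε := by rw [← Finset.mul_sum, hsum, mul_one]

lemma no_basis {X : Type} [MetricSpace X] [CompactSpace X] [Nonempty X]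
    (G : ℕ → C(X, ℂ)) (B C K : ℝ) (hB : ∀ n, ‖G n‖ ≤ B)
    (u : ℕ → C(X, ℂ) →L[ℂ] ℂ)
    (hu : ∀ n m : ℕ, u n (G m) = if n = m then 1 else 0)
    (hbes : ∀ n h, ∑ k ∈ range n, ‖u k h‖^2 ≤ C * ‖h‖^2)
    (hT : ∀ m h, ‖∑ k ∈ range m, u k h • G k‖ ≤ K * ‖h‖) : False := by
  obtain ⟨B1, hB1, hBB⟩ : ∃ B1, 1 ≤ B1 ∧ B ≤ B1 := ⟨max 1 B, le_max_left _ _, le_max_right _ _⟩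
  obtain ⟨C1, hC1, hCC⟩ : ∃ B1, 1 ≤ B1 ∧ C ≤ B1 := ⟨max 1 C, le_max_left _ _, le_max_right _ _⟩
  obtain ⟨K1, hK1, hKK⟩ : ∃ B1, 1 ≤ B1 ∧ K ≤ B1 := ⟨max 1 K, le_max_left _ _, le_max_right _ _⟩
  obtain ⟨r, hr⟩ := exists_nat_gt (16 * K1 / (1 / (8 * K1)) / (1 / (256 * B1^6 * (98 * C1)^4)))
  rw [div_lt_iff₀ (by positivity)] at hr
  refine absurd hr (not_lt.2 ?_)
  let M : ℝ := 1 + ∑ k ∈ range (2 * 2^r), ‖u k‖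
  have hM : ∀ k < 2 * 2^r, ‖u k‖ ≤ M := by
    intro k hk
    have := Finset.single_le_sum (f := fun k => ‖u k‖) (fun _ _ => norm_nonneg _) (Finset.mem_range.2 hk)
    simp only [M]; linarith
  have hM0 : 0 < M := by positivity
  obtain ⟨ι, _, _, x, p, hp, hG⟩ := discretize (2 * 2^r) G (1 / (12 * (2 * 2^r)) / M) (by positivity)
  have hv : ∀ k (h : ι → ℂ), ∑ j, u k (p j) * h j = u k (∑ j, h j • p j) := by
    intro k h
    rw [map_sum]
    refine Finset.sum_congr rfl fun j _ => ?_
    rw [map_smul, smul_eq_mul, mul_comm]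
  refine finite_main r (fun k j => u k (p j)) (fun k j => G k (x j)) B1 C1 K1 hB1 hC1 hK1 ?_ ?_ ?_ ?_
  · intro k i
    exact ((G k).norm_coe_le_norm _).trans ((hB k).trans hBB)
  · intro m h hh i
    simp only [hv]
    have h1 := hT m (∑ j, h j • p j)
    have h2 := hp h 1 hh zero_le_one
    have h3 := (∑ k ∈ range m, u k (∑ j, h j • p j) • G k).norm_coe_le_norm (x i)
    simp only [ContinuousMap.coe_sum, ContinuousMap.coe_smul, Finset.sum_apply, Pi.smul_apply, smul_eq_mul] at h3
    refine h3.trans (h1.trans ?_)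
    nlinarith [norm_nonneg (∑ j, h j • p j)]
  · intro h ρ hρ hh
    unfold qf
    simp only [hv]
    refine (hbes _ _).trans ?_
    have h2 := hp h ρ hh hρ
    gcongr
  · intro k hk l hl
    rw [hv, ← hu, ← map_sub]
    refine ((u k).le_opNorm _).trans ?_
    calc ‖u k‖ * _ ≤ M * (1 / (12 * (2 * 2^r)) / M) := by
          gcongr
          · exact hM k hk
          · exact hG l hl
      _ = _ := by field_simp

lemma evalR_cont (g : C(↥(Set.Icc (-Real.pi) Real.pi), ℂ)) : Continuous (evalR g) := by
  unfold evalR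
  exact g.continuous.comp continuous_projIcc

lemma evalR_norm (g : C(↥(Set.Icc (-Real.pi) Real.pi), ℂ)) (ω : ℝ) : ‖evalR g ω‖ ≤ ‖g‖ :=
  g.norm_coe_le_norm _

lemma pair_integrable (g : C(↥(Set.Icc (-Real.pi) Real.pi), ℂ)) (f : ℝ → ℂ)
    (hf : IntegrableOn f (Set.Icc (-Real.pi) Real.pi)) :
    IntegrableOn (fun ω => f ω * evalR g ω) (Set.Icc (-Real.pi) Real.pi) :=
  Integrable.mul_bdd (c := ‖g‖) hf (evalR_cont g).aestronglyMeasurable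
    (Filter.Eventually.of_forall (evalR_norm g))

lemma sup_of_pairing (g : C(↥(Set.Icc (-Real.pi) Real.pi), ℂ)) (M : ℝ) (hM : 0 ≤ M)
    (h : ∀ f : ℝ → ℂ, Continuous f →
      ‖∫ ω in Set.Icc (-Real.pi) Real.pi, f ω * evalR g ω‖
        ≤ M * ∫ ω in Set.Icc (-Real.pi) Real.pi, ‖f ω‖) : ‖g‖ ≤ M := by
  have hpi := Real.pi_pos
  have hc := evalR_cont g
  let w : ℝ → ℝ := fun ω => max (‖evalR g ω‖ - M) 0
  have hw : Continuous w := by fun_prop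
  have hw0 : ∀ ω, 0 ≤ w ω := fun ω => le_max_right _ _
  let f : ℝ → ℂ := fun ω => (starRingEnd ℂ) (evalR g ω) * w ω
  have hf : Continuous f := by fun_prop
  have h1 := h f hf
  have e1 : ∀ ω, f ω * evalR g ω = ((‖evalR g ω‖^2 * w ω : ℝ) : ℂ) := by
    intro ω
    have : (starRingEnd ℂ) (evalR g ω) * evalR g ω = ((‖evalR g ω‖^2 : ℝ) : ℂ) := by
      rw [mul_comm, Complex.mul_conj, Complex.normSq_eq_norm_sq]
    simp only [f]
    rw [mul_right_comm, this]; push_cast; ring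
  have e2 : ∀ ω, ‖f ω‖ = ‖evalR g ω‖ * w ω := by
    intro ω
    simp [f, abs_of_nonneg (hw0 ω)]
  simp_rw [e1, e2] at h1
  rw [integral_complex_ofReal, Complex.norm_real] at h1
  have h2 := (le_abs_self _).trans h1
  have i1 : IntegrableOn (fun ω => ‖evalR g ω‖^2 * w ω) (Set.Icc (-Real.pi) Real.pi) :=
    (by fun_prop : Continuous (fun ω => ‖evalR g ω‖^2 * w ω)).integrableOn_Icc
  have i2 : IntegrableOn (fun ω => M * (‖evalR g ω‖ * w ω)) (Set.Icc (-Real.pi) Real.pi) :=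
    (by fun_prop : Continuous (fun ω => M * (‖evalR g ω‖ * w ω))).integrableOn_Icc
  rw [← integral_const_mul] at h2
  by_contra hlt
  push Not at hlt
  have hx : ∃ x, M < ‖g x‖ := by
    by_contra hx
    push Not at hx
    exact absurd ((ContinuousMap.norm_le _ hM).2 hx) (not_le.2 hlt)
  obtain ⟨x, hx⟩ := hx
  have hxe : evalR g x = g x := by
    unfold evalR
    rw [Set.projIcc_val]
  have hpos : 0 < ∫ ω in (-Real.pi)..Real.pi,
      (‖evalR g ω‖^2 * w ω - M * (‖evalR g ω‖ * w ω)) := by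
    refine intervalIntegral.integral_pos (by linarith) (by fun_prop) ?_ ?_
    · intro ω _
      have : ‖evalR g ω‖^2 * w ω - M * (‖evalR g ω‖ * w ω)
          = ‖evalR g ω‖ * (w ω * (‖evalR g ω‖ - M)) := by ring
      rw [this]
      refine mul_nonneg (norm_nonneg _) ?_
      by_cases hm : M ≤ ‖evalR g ω‖
      · exact mul_nonneg (hw0 ω) (by linarith)
      · have : w ω = 0 := max_eq_right (by linarith)
        simp [this]
    · refine ⟨x, x.2, ?_⟩
      have hwx : w x = ‖g x‖ - M := by
        simp only [w, hxe]; exact max_eq_left (by linarith)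
      rw [hwx, hxe]
      have : ‖g x‖^2 * (‖g x‖ - M) - M * (‖g x‖ * (‖g x‖ - M)) = ‖g x‖ * (‖g x‖ - M)^2 := by ring
      rw [this]
      have h3 : 0 < ‖g x‖ - M := by linarith
      have h4 : 0 < ‖g x‖ := by linarith
      positivity
  rw [intervalIntegral.integral_of_le (by linarith), ← integral_Icc_eq_integral_Ioc,
    integral_sub i1 i2] at hpos
  linarith

lemma unif_bdd (g : ℕ → C(↥(Set.Icc (-Real.pi) Real.pi), ℂ))
    (h : ∀ f : ℝ → ℂ, IntegrableOn f (Set.Icc (-Real.pi) Real.pi) →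
      ∃ c : ℝ, ∀ N, ‖∫ ω in Set.Icc (-Real.pi) Real.pi, f ω * evalR (g N) ω‖ ≤ c) :
    ∃ M : ℝ, ∀ N, ‖g N‖ ≤ M := by
  let ν : Measure ℝ := volume.restrict (Set.Icc (-Real.pi) Real.pi)
  have hfInt : ∀ f : Lp ℂ 1 ν, Integrable f ν := fun f => L1.integrable_coeFn f
  let L : ℕ → (Lp ℂ 1 ν →L[ℂ] ℂ) := fun N => LinearMap.mkContinuous
    { toFun := fun f => ∫ ω, f ω * evalR (g N) ω ∂ν
      map_add' := by
        intro f1 f2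
        rw [← integral_add (pair_integrable (g N) _ (hfInt f1)) (pair_integrable (g N) _ (hfInt f2))]
        refine integral_congr_ae ?_
        filter_upwards [Lp.coeFn_add f1 f2] with ω hω
        rw [hω, Pi.add_apply, add_mul]
      map_smul' := by
        intro c f
        rw [RingHom.id_apply, smul_eq_mul, ← integral_const_mul]
        refine integral_congr_ae ?_
        filter_upwards [Lp.coeFn_smul c f] with ω hω
        rw [hω, Pi.smul_apply, smul_eq_mul, mul_assoc] } ‖g N‖ (by
        intro f
        change ‖∫ ω, f ω * evalR (g N) ω ∂ν‖ ≤ _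
        rw [L1.norm_eq_integral_norm, ← integral_const_mul]
        refine norm_integral_le_of_norm_le ((hfInt f).norm.const_mul _) (Eventually.of_forall ?_)
        intro ω
        rw [norm_mul, mul_comm]
        exact mul_le_mul_of_nonneg_right (evalR_norm _ _) (norm_nonneg _))
  have hL : ∀ N f, L N f = ∫ ω, f ω * evalR (g N) ω ∂ν := fun _ _ => rfl
  obtain ⟨M, hM⟩ := banach_steinhaus (g := L) (by
    intro f
    obtain ⟨c, hc⟩ := h f (hfInt f)
    exact ⟨c, fun N => by rw [hL]; exact hc N⟩)
  have hM0 : 0 ≤ M := (norm_nonneg _).trans (hM 0)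
  refine ⟨M, fun N => sup_of_pairing (g N) M hM0 ?_⟩
  intro f hf
  have hfi : Integrable f ν := hf.integrableOn_Icc
  have h1 := (L N).le_of_opNorm_le (hM N) (hfi.toL1 f)
  rw [hL] at h1
  have h2 : ∫ ω, (hfi.toL1 f) ω * evalR (g N) ω ∂ν = ∫ ω, f ω * evalR (g N) ω ∂ν := by
    refine integral_congr_ae ?_
    filter_upwards [hfi.coeFn_toL1] with ω hω
    rw [hω]
  have h3 : ‖hfi.toL1 f‖ = ∫ ω, ‖f ω‖ ∂ν := by
    rw [L1.norm_eq_integral_norm]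
    refine integral_congr_ae ?_
    filter_upwards [hfi.coeFn_toL1] with ω hω
    rw [hω]
  rw [h2, h3] at h1
  exact h1

lemma bdd_of_limsup (a : ℕ → ℂ)
    (h : Filter.limsup (fun N : ℕ => (‖a N‖₊ : ENNReal)) Filter.atTop ≠ ⊤) :
    ∃ c : ℝ, ∀ N, ‖a N‖ ≤ c := by
  obtain ⟨b, hb1, hb2⟩ := exists_between (lt_top_iff_ne_top.2 h)
  have h1 := Filter.eventually_lt_of_limsup_lt hb1
  obtain ⟨N0, hN0⟩ := Filter.eventually_atTop.1 h1
  refine ⟨b.toReal + ∑ k ∈ range N0, ‖a k‖, fun N => ?_⟩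
  have hs : 0 ≤ ∑ k ∈ range N0, ‖a k‖ := by positivity
  by_cases hN : N < N0
  · have := Finset.single_le_sum (f := fun k => ‖a k‖) (fun _ _ => norm_nonneg _) (Finset.mem_range.2 hN)
    have h3 : 0 ≤ b.toReal := ENNReal.toReal_nonneg
    linarith
  · have := hN0 N (not_lt.1 hN)
    have h3 := (ENNReal.toReal_mono hb2.ne this.le)
    simp only [ENNReal.coe_toReal, coe_nnnorm] at h3
    linarith

lemma bessel_dense (G : ℕ → C(↥(Set.Icc (-Real.pi) Real.pi), ℂ))
    (hGclosed : ∀ u : C(↥(Set.Icc (-Real.pi) Real.pi), ℂ), ∀ ε : ℝ, 0 < ε →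
      ∃ (N : ℕ) (a : ℕ → ℂ), ‖u - ∑ n ∈ Finset.range N, a n • G n‖ < ε)
    (C₁₃ : ℝ) (hC₁₃pos : 0 < C₁₃)
    (hC₁₃ : ∀ (s : Finset ℕ) (a : ℕ → ℂ),
      C₁₃⁻¹ * Real.sqrt (∑ n ∈ s, ‖a n‖ ^ 2) ≤ ‖∑ n ∈ s, a n • G n‖)
    (u : ℕ → C(↥(Set.Icc (-Real.pi) Real.pi), ℂ) →L[ℂ] ℂ)
    (hu : ∀ n m : ℕ, u n (G m) = if n = m then 1 else 0) (n : ℕ)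
    (h : C(↥(Set.Icc (-Real.pi) Real.pi), ℂ)) :
    ∑ k ∈ range n, ‖u k h‖^2 ≤ C₁₃^2 * ‖h‖^2 := by
  let S : Set C(↥(Set.Icc (-Real.pi) Real.pi), ℂ) :=
    {h | ∑ k ∈ range n, ‖u k h‖^2 ≤ C₁₃^2 * ‖h‖^2}
  have hS : IsClosed S := isClosed_le (by fun_prop) (by fun_prop)
  change h ∈ S
  rw [← hS.closure_eq, Metric.mem_closure_iff]
  intro ε hε
  obtain ⟨N, a, ha⟩ := hGclosed h ε hε
  refine ⟨_, ?_, by rw [dist_eq_norm]; exact ha⟩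
  change ∑ k ∈ range n, ‖u k (∑ n ∈ Finset.range N, a n • G n)‖^2 ≤ _
  have e : ∀ k, u k (∑ n ∈ Finset.range N, a n • G n) = if k ∈ range N then a k else 0 := by
    intro k
    rw [map_sum]
    simp [hu]
  simp_rw [e]
  have h1 : ∑ k ∈ range n, ‖if k ∈ range N then a k else 0‖^2 ≤ ∑ k ∈ range N, ‖a k‖^2 := by
    calc _ = ∑ k ∈ range n, if k ∈ range N then ‖a k‖^2 else 0 := by
          refine Finset.sum_congr rfl fun k _ => ?_
          split_ifs <;> simp
      _ = ∑ k ∈ range n ∩ range N, ‖a k‖^2 := by rw [← Finset.sum_ite_mem]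
      _ ≤ _ := Finset.sum_le_sum_of_subset_of_nonneg Finset.inter_subset_right
          (fun _ _ _ => by positivity)
  refine h1.trans ?_
  have h2 := hC₁₃ (range N) a
  rw [inv_mul_le_iff₀ hC₁₃pos] at h2
  rw [← mul_pow]
  calc ∑ k ∈ range N, ‖a k‖^2 = Real.sqrt (∑ k ∈ range N, ‖a k‖^2)^2 :=
        (Real.sq_sqrt (by positivity)).symm
    _ ≤ _ := by gcongr

theorem stmt13 (G : ℕ → C(↥(Set.Icc (-Real.pi) Real.pi), ℂ))
    (hGbdd : ∃ B : ℝ, ∀ n, ‖G n‖ ≤ B)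
    (hGlow : ∃ b : ℝ, 0 < b ∧ ∀ n, b ≤ ‖G n‖)
    (hGclosed : ∀ u : C(↥(Set.Icc (-Real.pi) Real.pi), ℂ), ∀ ε : ℝ, 0 < ε →
      ∃ (N : ℕ) (a : ℕ → ℂ), ‖u - ∑ n ∈ Finset.range N, a n • G n‖ < ε)
    (hGmin : ∀ m : ℕ,
      G m ∉ closure (↑(Submodule.span ℂ (G '' {n | n ≠ m})) :
        Set C(↥(Set.Icc (-Real.pi) Real.pi), ℂ)))
    (C₁₃ : ℝ) (hC₁₃pos : 0 < C₁₃)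
    (hC₁₃ : ∀ (s : Finset ℕ) (a : ℕ → ℂ),
      C₁₃⁻¹ * Real.sqrt (∑ n ∈ s, ‖a n‖ ^ 2) ≤ ‖∑ n ∈ s, a n • G n‖)
    (u : ℕ → C(↥(Set.Icc (-Real.pi) Real.pi), ℂ) →L[ℂ] ℂ)
    (hu : ∀ n m : ℕ, u n (G m) = if n = m then 1 else 0)
    (t : ℝ) :
    ∃ hstar : C(↥(Set.Icc (-Real.pi) Real.pi), ℂ),
      ∃ fstarhat : ℝ → ℂ,
        IntegrableOn fstarhat (Set.Icc (-Real.pi) Real.pi) ∧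
        Filter.limsup (fun N : ℕ =>
            (‖∑ n ∈ Finset.range N,
                ((1 / (2 * Real.pi)) *
                    ∫ ω in Set.Icc (-Real.pi) Real.pi,
                      fstarhat ω * evalR (G n) ω) *
                u n (hstar * expCM t)‖₊ : ENNReal))
          Filter.atTop = ⊤ := by
  by_contra hcon
  push Not at hcon
  have hpi := Real.pi_pos
  obtain ⟨B, hB⟩ := hGbdd
  haveI : Nonempty ↥(Set.Icc (-Real.pi) Real.pi) := ⟨⟨0, by constructor <;> linarith⟩⟩
  let T : ℕ → C(↥(Set.Icc (-Real.pi) Real.pi), ℂ) →L[ℂ] C(↥(Set.Icc (-Real.pi) Real.pi), ℂ) :=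
    fun N => ∑ k ∈ range N, (u k).smulRight (G k)
  have hTa : ∀ N h, T N h = ∑ k ∈ range N, u k h • G k := by
    intro N h; simp [T, ContinuousLinearMap.sum_apply]
  have hbd : ∀ h, ∃ c : ℝ, ∀ N, ‖T N h‖ ≤ c := by
    intro h
    refine unif_bdd (fun N => T N h) ?_
    intro f hf
    obtain ⟨c, hc⟩ := bdd_of_limsup _ (hcon (h * expCM (-t)) f hf)
    refine ⟨2 * Real.pi * c, fun N => ?_⟩
    have hexp : h * expCM (-t) * expCM t = h := by
      ext ω
      simp only [expCM, ContinuousMap.mul_apply, ContinuousMap.coe_mk]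
      rw [mul_assoc, ← Complex.exp_add]
      simp
    have h1 := hc N
    rw [hexp] at h1
    have h2 : ∑ n ∈ Finset.range N, ((1 / (2 * Real.pi)) *
        ∫ ω in Set.Icc (-Real.pi) Real.pi, f ω * evalR (G n) ω) * u n h
        = (1 / (2 * Real.pi)) * ∫ ω in Set.Icc (-Real.pi) Real.pi, f ω * evalR (T N h) ω := by
      have h3 : ∀ ω, f ω * evalR (T N h) ω = ∑ k ∈ range N, u k h * (f ω * evalR (G k) ω) := by
        intro ω
        rw [hTa]
        simp only [evalR, ContinuousMap.coe_sum, ContinuousMap.coe_smul, Finset.sum_apply,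
          Pi.smul_apply, smul_eq_mul, Finset.mul_sum]
        exact Finset.sum_congr rfl fun k _ => by ring
      simp_rw [h3]
      rw [integral_finsetSum _ (fun k _ => (pair_integrable (G k) f hf).const_mul _), Finset.mul_sum]
      refine Finset.sum_congr rfl fun k _ => ?_
      rw [integral_const_mul]; ring
    rw [h2, norm_mul] at h1
    have h4 : ‖(1 / (2 * Real.pi) : ℂ)‖ = 1 / (2 * Real.pi) := by
      simp [abs_of_pos hpi]
    rw [h4, one_div, inv_mul_le_iff₀ (by positivity)] at h1
    exact h1
  obtain ⟨K, hK⟩ := banach_steinhaus hbd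
  refine no_basis G B (C₁₃^2) K hB u hu
    (bessel_dense G hGclosed C₁₃ hC₁₃pos hC₁₃ u hu) ?_
  intro m h
  rw [← hTa]
  exact (T m).le_of_opNorm_le (hK m) h
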